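/- Let μ < 0 be a real number and n ≥ 1 an integer. Then the meromorphic continuation F_{2n, 2(μ+n)} of ζ_{2n, 2(μ+n)} is analytic on an open neighborhood of the point z = −2μ = 2|μ|; in particular lim_{z→2|μ|} (z−2|μ|)·F_{2n,2(μ+n)}(z) = 0, i.e. the residue at z = 2|μ| vanishes. -/

import Mathlib

open Complex Real Filter Finset Topology

/-- The q-number `[x]_q = (q^x - q^{-x})/(q - q⁻¹)`. -/
noncomputable def qnum (q x : ℝ) : ℝ := (q ^ x - q ^ (-x)) / (q - q⁻¹)

/-- For a positive real `a` and `w : ℂ`, `a^w := exp(w · ln a)`. -/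
noncomputable def rcpow (a : ℝ) (w : ℂ) : ℂ := Complex.exp (w * (Real.log a : ℂ))

/-- The `(n,j)`-term of the q-zeta double series, corresponding to
`l = n + 1/2` and `k = j - n - 1/2`: `q^{βl+δk} · [l+1/2]_q^{-z}`. -/
noncomputable def qzetaTerm (q β δ : ℝ) (z : ℂ) (n j : ℕ) : ℂ :=
  ((q ^ (β * ((n : ℝ) + 1/2) + δ * ((j : ℝ) - (n : ℝ) - 1/2)) : ℝ) : ℂ) *
    rcpow (qnum q ((n : ℝ) + 1)) (-z)

/-- The q-zeta function `ζ_{β,δ}(z)` as a double series. -/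
noncomputable def qzeta (q β δ : ℝ) (z : ℂ) : ℂ :=
  ∑' n : ℕ, ∑ j ∈ Finset.range (2 * n + 2), qzetaTerm q β δ z n j

/-- The generalized binomial coefficient `C(z+j-1, j) = (1/j!)·∏_{i=0}^{j-1}(z+i)`. -/
noncomputable def binomC (z : ℂ) (j : ℕ) : ℂ :=
  (∏ i ∈ Finset.range j, (z + (i : ℂ))) / (Nat.factorial j : ℂ)

/-- The `j`-th term of the series defining `F_{β,δ}(z)`. -/
noncomputable def Fterm (q β δ : ℝ) (z : ℂ) (j : ℕ) : ℂ :=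
  binomC z j * (q : ℂ) ^ (2 * j) /
    ((1 - rcpow q (((β - δ + 2 * (j : ℝ)) : ℝ) + z)) *
     (1 - rcpow q (((β + δ + 2 * (j : ℝ)) : ℝ) + z)))

/-- The meromorphic continuation `F_{β,δ}`. -/
noncomputable def Ffun (q β δ : ℝ) (z : ℂ) : ℂ :=
  ((q ^ (β / 2) * (q ^ (-δ / 2) + q ^ (δ / 2)) : ℝ) : ℂ) * rcpow (1 - q ^ 2) z *
    ∑' j : ℕ, Fterm q β δ z j

theorem norm_binomC_le {z : ℂ} {k : ℕ} (hz : ‖z‖ ≤ k + 1) (j : ℕ) :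
    ‖binomC z j‖ ≤ ((j + k).choose k : ℝ) := by
  have hj : (0 : ℝ) < (j.factorial : ℝ) := by exact_mod_cast j.factorial_pos
  rw [binomC, norm_div, norm_prod, Complex.norm_natCast, div_le_iff₀ hj]
  calc ∏ i ∈ Finset.range j, ‖z + (i : ℂ)‖
      ≤ ∏ i ∈ Finset.range j, ((k + 1 + i : ℕ) : ℝ) := by
        refine Finset.prod_le_prod (fun _ _ => norm_nonneg _) fun i _ => ?_
        refine (norm_add_le _ _).trans ?_
        rw [Complex.norm_natCast]
        push_cast
        linarith
    _ = ((j + k).choose k : ℝ) * (j.factorial : ℝ) := by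
        rw [← Nat.cast_prod, ← Nat.ascFactorial_eq_prod_range,
          Nat.ascFactorial_eq_factorial_mul_choose, Nat.add_comm k j, Nat.choose_symm_add]
        push_cast
        ring

theorem norm_rcpow {a : ℝ} (ha : 0 < a) (w : ℂ) : ‖rcpow a w‖ = a ^ w.re := by
  rw [rcpow, Complex.norm_exp, Complex.re_mul_ofReal, Real.rpow_def_of_pos ha, mul_comm]

theorem one_sub_rpow_le_norm_one_sub_rcpow {q m : ℝ} (hq0 : 0 < q) (hq1 : q < 1) {w : ℂ}
    (hw : m ≤ w.re) : 1 - q ^ m ≤ ‖1 - rcpow q w‖ := by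
  have h := norm_sub_norm_le (1 : ℂ) (rcpow q w)
  rw [norm_one, norm_rcpow hq0] at h
  linarith [Real.rpow_le_rpow_of_exponent_ge hq0 hq1.le hw]

theorem differentiable_rcpow (a : ℝ) : Differentiable ℂ (rcpow a) := by
  unfold rcpow
  fun_prop

theorem differentiable_binomC (j : ℕ) : Differentiable ℂ (fun z => binomC z j) := by
  unfold binomC
  fun_prop

/-- `F_{β,δ}` is holomorphic on every bounded open set on which the exponents `β ± δ + z` have
real parts bounded below by a positive constant. -/
theorem differentiableOn_Ffun {q β δ m : ℝ} (hq0 : 0 < q) (hq1 : q < 1) (hm : 0 < m) {k : ℕ}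
    {U : Set ℂ} (hU : IsOpen U) (hk : ∀ z ∈ U, ‖z‖ ≤ k + 1)
    (hsub : ∀ z ∈ U, m ≤ β - δ + z.re) (hadd : ∀ z ∈ U, m ≤ β + δ + z.re) :
    DifferentiableOn ℂ (Ffun q β δ) U := by
  have hc : 0 < 1 - q ^ m := sub_pos.2 (Real.rpow_lt_one hq0.le hq1 hm)
  have hden {c : ℝ} {z : ℂ} (hz : m ≤ c + z.re) (j : ℕ) :
      1 - q ^ m ≤ ‖1 - rcpow q (((c + 2 * (j : ℝ)) : ℝ) + z)‖ := by
    refine one_sub_rpow_le_norm_one_sub_rcpow hq0 hq1 ?_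
    rw [Complex.add_re, Complex.ofReal_re]
    have : (0 : ℝ) ≤ j := j.cast_nonneg
    linarith
  have hne {c : ℝ} {z : ℂ} (hz : m ≤ c + z.re) (j : ℕ) :
      1 - rcpow q (((c + 2 * (j : ℝ)) : ℝ) + z) ≠ 0 :=
    norm_pos_iff.1 (hc.trans_le (hden hz j))
  have hsum : Summable fun j : ℕ =>
      ((j + k).choose k : ℝ) * (q ^ 2) ^ j / ((1 - q ^ m) * (1 - q ^ m)) := by
    have hq2 : ‖q ^ 2‖ < 1 := by
      rw [Real.norm_of_nonneg (by positivity)]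
      exact pow_lt_one₀ hq0.le hq1 two_ne_zero
    exact (summable_choose_mul_geometric_of_norm_lt_one k hq2).div_const _
  have hrc (c : ℝ) : Differentiable ℂ fun z : ℂ => rcpow q ((c : ℂ) + z) :=
    (differentiable_rcpow q).comp (differentiable_id.const_add _)
  have htsum : DifferentiableOn ℂ (fun z => ∑' j : ℕ, Fterm q β δ z j) U := by
    refine Complex.differentiableOn_tsum_of_summable_norm hsum (fun j => ?_) hU fun j z hz => ?_
    · unfold Fterm
      refine DifferentiableOn.div
        ((differentiable_binomC j).mul_const _).differentiableOn
        (((hrc _).const_sub _).mul ((hrc _).const_sub _)).differentiableOn fun z hz => ?_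
      exact mul_ne_zero (hne (hsub z hz) j) (hne (hadd z hz) j)
    · rw [Fterm, norm_div, norm_mul, norm_mul, norm_pow, Complex.norm_real,
        Real.norm_of_nonneg hq0.le, pow_mul]
      gcongr
      · exact norm_binomC_le (hk z hz) j
      · exact hden (hsub z hz) j
      · exact hden (hadd z hz) j
  unfold Ffun
  exact ((differentiable_rcpow _).const_mul _).differentiableOn.mul htsum

theorem statement16 (q : ℝ) (hq0 : 0 < q) (hq1 : q < 1) (μ : ℝ) (hμ : μ < 0)
    (n : ℕ) (hn : 1 ≤ n) :
    (∃ U : Set ℂ, IsOpen U ∧ ((2 * |μ| : ℝ) : ℂ) ∈ U ∧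
      DifferentiableOn ℂ (Ffun q (2 * (n : ℝ)) (2 * (μ + (n : ℝ)))) U) ∧
    Tendsto (fun z : ℂ => (z - ((2 * |μ| : ℝ) : ℂ)) * Ffun q (2 * (n : ℝ)) (2 * (μ + (n : ℝ))) z)
      (𝓝[≠] ((2 * |μ| : ℝ) : ℂ)) (𝓝 0) := by
  obtain ⟨U, hU, hmem, hd⟩ : ∃ U : Set ℂ, IsOpen U ∧ ((2 * |μ| : ℝ) : ℂ) ∈ U ∧
      DifferentiableOn ℂ (Ffun q (2 * (n : ℝ)) (2 * (μ + (n : ℝ)))) U := by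
    have hn' : (1 : ℝ) ≤ n := by exact_mod_cast hn
    have hr : 0 < min 1 |μ| := lt_min one_pos (abs_pos.2 hμ.ne)
    obtain ⟨k, hk⟩ := exists_nat_ge (2 * |μ|)
    have hre (z : ℂ) (hz : z ∈ Metric.ball ((2 * |μ| : ℝ) : ℂ) (min 1 |μ|)) :
        2 * |μ| - min 1 |μ| ≤ z.re := by
      rw [mem_ball_iff_norm] at hz
      have h := (abs_le.1 (Complex.abs_re_le_norm (z - ((2 * |μ| : ℝ) : ℂ)))).1
      rw [Complex.sub_re, Complex.ofReal_re] at h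
      linarith
    refine ⟨Metric.ball ((2 * |μ| : ℝ) : ℂ) (min 1 |μ|), Metric.isOpen_ball,
      Metric.mem_ball_self hr,
      differentiableOn_Ffun (m := min 1 |μ|) (k := k) hq0 hq1 hr Metric.isOpen_ball
        (fun z hz => ?_) (fun z hz => ?_) fun z hz => ?_⟩
    · rw [mem_ball_iff_norm] at hz
      have h := norm_le_norm_add_norm_sub' z ((2 * |μ| : ℝ) : ℂ)
      rw [Complex.norm_real, Real.norm_of_nonneg (by positivity)] at h
      linarith [min_le_left 1 |μ|]
    · linarith [hre z hz, min_le_right 1 |μ|, abs_of_neg hμ]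
    · linarith [hre z hz, min_le_left 1 |μ|, abs_of_neg hμ]
  refine ⟨⟨U, hU, hmem, hd⟩, ?_⟩
  have hF := (hd.differentiableAt (hU.mem_nhds hmem)).continuousAt
  have h := ((tendsto_id.sub_const ((2 * |μ| : ℝ) : ℂ)).mul hF.tendsto).mono_left
    (nhdsWithin_le_nhds (s := {((2 * |μ| : ℝ) : ℂ)}ᶜ))
  rw [sub_self, zero_mul] at h
  exact h
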